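/- There exists a Legendre pair (A, B) of length 117 such that moreover the sets I_A = {i ∈ ℤ_117 : a_i = 1} and I_B = {i ∈ ℤ_117 : b_i = 1} are each invariant under multiplication by 16 modulo 117 (so that the multiplier group of each sequence contains the order-3 subgroup {1, 16, 22} of ℤ_117*). -/

import Mathlib

/-- The periodic autocorrelation function of a sequence indexed by `ℤ_ℓ`:
`PAF(A,s) = ∑_{i} a_i a_{i+s}`. -/
def paf (ℓ : ℕ) [NeZero ℓ] (a : ZMod ℓ → ℤ) (s : ZMod ℓ) : ℤ :=
  ∑ i : ZMod ℓ, a i * a (i + s)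

/-- Two `±1` sequences indexed by `ℤ_ℓ` with entry sums equal to 1 form a Legendre pair
if `PAF(A,s) + PAF(B,s) = -2` for all `s = 1, …, (ℓ-1)/2`. -/
def IsLegendrePair (ℓ : ℕ) [NeZero ℓ] (a b : ZMod ℓ → ℤ) : Prop :=
  (∀ i, a i = 1 ∨ a i = -1) ∧
  (∀ i, b i = 1 ∨ b i = -1) ∧
  (∑ i : ZMod ℓ, a i = 1) ∧
  (∑ i : ZMod ℓ, b i = 1) ∧
  (∀ s : ℕ, 1 ≤ s → s ≤ (ℓ - 1) / 2 → paf ℓ a (s : ZMod ℓ) + paf ℓ b (s : ZMod ℓ) = -2)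

/-- The `±1` sequence indexed by `ℤ_117` whose `+1` entries are the positions of the nonzero
binary digits of `n`. -/
def signSeq (n : ℕ) (i : ZMod 117) : ℤ := if n.testBit i.val then 1 else -1

theorem signSeq_eq_one_or (n : ℕ) (i : ZMod 117) : signSeq n i = 1 ∨ signSeq n i = -1 := by
  unfold signSeq
  split <;> simp

/-- The number of `i < k` such that the binary digits of `n` at the positions `i` and
`(i + s) % 117` differ. -/
def disagreements (n s : ℕ) : ℕ → ℕ
  | 0 => 0
  | k + 1 => disagreements n s k + (n / 2 ^ k + n / 2 ^ ((k + s) % 117)) % 2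

theorem disagreements_eq_sum (n s k : ℕ) :
    disagreements n s k =
      ∑ i ∈ Finset.range k, (n / 2 ^ i + n / 2 ^ ((i + s) % 117)) % 2 := by
  induction k with
  | zero => rfl
  | succ k ih => rw [Finset.sum_range_succ, disagreements, ih]

theorem paf_signSeq (n s : ℕ) :
    paf 117 (signSeq n) s = 117 - 2 * (disagreements n s 117 : ℤ) := by
  have key : ∀ i : ZMod 117, signSeq n i * signSeq n (i + s) =
      1 - 2 * (((n / 2 ^ i.val + n / 2 ^ ((i.val + s) % 117)) % 2 : ℕ) : ℤ) := by
    intro i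
    have hi : (i + (s : ZMod 117)).val = (i.val + s) % 117 := by
      rw [ZMod.val_add, ZMod.val_natCast, Nat.add_mod_mod]
    simp only [signSeq, hi, Nat.testBit_eq_decide_div_mod_eq, decide_eq_true_eq]
    split <;> split <;> omega
  rw [paf, Finset.sum_congr rfl fun i _ => key i, disagreements_eq_sum, Finset.sum_range,
    Finset.sum_sub_distrib, ← Finset.mul_sum, Nat.cast_sum]
  simp only [Finset.sum_const, Finset.card_univ, ZMod.card, nsmul_eq_mul, mul_one]
  rfl

/-- A set defined by a function invariant under multiplication by a unit is mapped onto itself by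
that multiplication. -/
theorem image_mul_left_eq_of_invariant {R α : Type*} [CommMonoid R] {u v : R} (huv : u * v = 1)
    {f : R → α} (hf : ∀ i, f (u * i) = f i) (c : α) :
    (fun i => u * i) '' {i | f i = c} = {i | f i = c} := by
  ext i
  simp only [Set.mem_image, Set.mem_ofPred_eq]
  refine ⟨?_, fun hi => ⟨v * i, ?_, by rw [← mul_assoc, huv, one_mul]⟩⟩
  · rintro ⟨j, hj, rfl⟩
    rw [hf, hj]
  · rw [← hf, ← mul_assoc, huv, one_mul, hi]

/-- The indicator of the `+1` entries of the first sequence of the pair. -/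
def maskA : ℕ := 143548575758405276387023131001782988

/-- The indicator of the `+1` entries of the second sequence of the pair. -/
def maskB : ℕ := 160975847801741492594642508386152340

theorem isLegendrePair_signSeq_maskA_maskB :
    IsLegendrePair 117 (signSeq maskA) (signSeq maskB) := by
  refine ⟨signSeq_eq_one_or _, signSeq_eq_one_or _, by decide +kernel, by decide +kernel, ?_⟩
  have h : ∀ s < 59, 1 ≤ s → disagreements maskA s 117 + disagreements maskB s 117 = 118 := by
    decide +kernel
  intro s h1 h2
  have hs := h s (by omega) h1
  rw [paf_signSeq, paf_signSeq]
  omega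

/-- There exists a Legendre pair `(A,B)` of length 117 such that the sets
`I_A = {i : a_i = 1}` and `I_B = {i : b_i = 1}` are each invariant under multiplication
by 16 modulo 117 (so the multiplier group of each sequence contains the order-3
subgroup {1, 16, 22} of `ℤ_117*`). -/
theorem legendre_pair_117_exists :
    ∃ a b : ZMod 117 → ℤ, IsLegendrePair 117 a b ∧
      (fun i => (16 : ZMod 117) * i) '' {i | a i = 1} = {i | a i = 1} ∧
      (fun i => (16 : ZMod 117) * i) '' {i | b i = 1} = {i | b i = 1} := by
  have huv : (16 : ZMod 117) * 22 = 1 := by decide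
  exact ⟨signSeq maskA, signSeq maskB, isLegendrePair_signSeq_maskA_maskB,
    image_mul_left_eq_of_invariant huv (by decide +kernel) 1,
    image_mul_left_eq_of_invariant huv (by decide +kernel) 1⟩
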